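/- arXiv:1910.08396 — 4 statements merged into one kernel-verified Lean document; each statement's English description precedes it below -/
import Mathlib

section
/- Let A, B, C, D be four distinct concyclic points in the Euclidean plane ℝ² forming a convex cyclic quadrilateral in this order. Let R₁ and p₁ be the inradius and semiperimeter of triangle ABC, and let R₂ and p₂ be the inradius and semiperimeter of triangle ACD. Then R₁ · R₂ = (p₁ − dist A C) · (p₂ − dist A C), i.e., the product of the two inradii equals the product of the tangent lengths from B in ABC and from D in ACD. -/
open Real EuclideanGeometry Metric MeasureTheory

/-- Twice the signed area of the triangle `PQX`. -/
noncomputable def signedArea (P Q X : EuclideanSpace ℝ (Fin 2)) : ℝ :=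
  (Q 0 - P 0) * (X 1 - P 1) - (Q 1 - P 1) * (X 0 - P 0)

lemma dist_sq_eq_coord (P Q : EuclideanSpace ℝ (Fin 2)) :
    dist P Q ^ 2 = (P 0 - Q 0) ^ 2 + (P 1 - Q 1) ^ 2 := by
  rw [EuclideanSpace.dist_eq, Real.sq_sqrt (by positivity), Fin.sum_univ_two, Real.dist_eq,
    Real.dist_eq, sq_abs, sq_abs]

lemma exists_coord_of_mem_line {P Q X : EuclideanSpace ℝ (Fin 2)}
    (hX : X ∈ affineSpan ℝ ({P, Q} : Set (EuclideanSpace ℝ (Fin 2)))) :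
    ∃ r : ℝ, ∀ i, X i = P i + r * (Q i - P i) := by
  obtain ⟨r, rfl⟩ := mem_affineSpan_pair_iff_exists_lineMap_eq.1 hX
  refine ⟨r, fun i => ?_⟩
  simp [AffineMap.lineMap_apply]
  ring

lemma infDist_line_mul_dist {P Q : EuclideanSpace ℝ (Fin 2)} (hPQ : P ≠ Q)
    (X : EuclideanSpace ℝ (Fin 2)) :
    infDist X (affineSpan ℝ ({P, Q} : Set (EuclideanSpace ℝ (Fin 2))) :
      Set (EuclideanSpace ℝ (Fin 2))) * dist P Q = |signedArea P Q X| := by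
  have hpos : 0 < dist P Q := dist_pos.2 hPQ
  have hd := dist_sq_eq_coord P Q
  apply le_antisymm
  · set r : ℝ := ((X 0 - P 0) * (Q 0 - P 0) + (X 1 - P 1) * (Q 1 - P 1)) / dist P Q ^ 2 with hr
    have hr' : r * dist P Q ^ 2 = (X 0 - P 0) * (Q 0 - P 0) + (X 1 - P 1) * (Q 1 - P 1) := by
      rw [hr]; field_simp
    have hmem : AffineMap.lineMap P Q r ∈
        affineSpan ℝ ({P, Q} : Set (EuclideanSpace ℝ (Fin 2))) :=
      AffineMap.lineMap_mem_affineSpan_pair r P Q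
    refine (mul_le_mul_of_nonneg_right (infDist_le_dist_of_mem hmem) hpos.le).trans ?_
    refine abs_le_of_sq_le_sq' ?_ (abs_nonneg _) |>.2
    have hH := dist_sq_eq_coord X (AffineMap.lineMap P Q r)
    simp only [AffineMap.lineMap_apply, vsub_eq_sub, vadd_eq_add, PiLp.add_apply, PiLp.smul_apply,
      PiLp.sub_apply, smul_eq_mul] at hH ⊢
    rw [mul_pow, hH, sq_abs, signedArea]
    rw [hd] at hr' ⊢
    apply le_of_eq
    linear_combination (r * ((P 0 - Q 0) ^ 2 + (P 1 - Q 1) ^ 2) -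
      ((X 0 - P 0) * (Q 0 - P 0) + (X 1 - P 1) * (Q 1 - P 1))) * hr'
  · rw [← div_le_iff₀ hpos]
    refine (le_infDist ⟨P, left_mem_affineSpan_pair ℝ P Q⟩).2 fun Y hY => ?_
    rw [div_le_iff₀ hpos]
    obtain ⟨r, hr⟩ := exists_coord_of_mem_line hY
    refine abs_le_of_sq_le_sq' ?_ (by positivity) |>.2
    rw [mul_pow, dist_sq_eq_coord X Y, hd, sq_abs, signedArea, hr 0, hr 1]
    nlinarith [sq_nonneg ((X 0 - (P 0 + r * (Q 0 - P 0))) * (Q 0 - P 0) +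
      (X 1 - (P 1 + r * (Q 1 - P 1))) * (Q 1 - P 1))]

lemma exists_weights_of_mem_convexHull_triple {A B C X : EuclideanSpace ℝ (Fin 2)}
    (hX : X ∈ convexHull ℝ ({A, B, C} : Set (EuclideanSpace ℝ (Fin 2)))) :
    ∃ a b c : ℝ, 0 ≤ a ∧ 0 ≤ b ∧ 0 ≤ c ∧ a + b + c = 1 ∧
      ∀ i, X i = a * A i + b * B i + c * C i := by
  rw [convexHull_insert (by simp), convexHull_pair, mem_convexJoin] at hX
  obtain ⟨P, rfl, Y, ⟨b, c, hb, hc, hbc, rfl⟩, ⟨a, d, ha, hd, had, rfl⟩⟩ := hX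
  refine ⟨a, d * b, d * c, ha, by positivity, by positivity, ?_, fun i => ?_⟩
  · linear_combination had + d * hbc
  · simp
    ring

/-- The inradius times the perimeter is twice the area. -/
lemma inradius_mul_perimeter {A B C X : EuclideanSpace ℝ (Fin 2)} {R : ℝ}
    (hAB : A ≠ B) (hBC : B ≠ C) (hCA : C ≠ A)
    (hX : X ∈ convexHull ℝ ({A, B, C} : Set (EuclideanSpace ℝ (Fin 2))))
    (h₁ : infDist X (affineSpan ℝ ({A, B} : Set (EuclideanSpace ℝ (Fin 2))) :
      Set (EuclideanSpace ℝ (Fin 2))) = R)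
    (h₂ : infDist X (affineSpan ℝ ({B, C} : Set (EuclideanSpace ℝ (Fin 2))) :
      Set (EuclideanSpace ℝ (Fin 2))) = R)
    (h₃ : infDist X (affineSpan ℝ ({C, A} : Set (EuclideanSpace ℝ (Fin 2))) :
      Set (EuclideanSpace ℝ (Fin 2))) = R) :
    R * (dist A B + dist B C + dist C A) = |signedArea A B C| := by
  obtain ⟨a, b, c, ha, hb, hc, habc, hw⟩ := exists_weights_of_mem_convexHull_triple hX
  have e₁ := infDist_line_mul_dist hAB X
  have e₂ := infDist_line_mul_dist hBC X
  have e₃ := infDist_line_mul_dist hCA X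
  obtain rfl : a = 1 - b - c := by linarith
  have f₁ : signedArea A B X = c * signedArea A B C := by
    simp only [signedArea, hw]; ring
  have f₂ : signedArea B C X = (1 - b - c) * signedArea A B C := by
    simp only [signedArea, hw]; ring
  have f₃ : signedArea C A X = b * signedArea A B C := by
    simp only [signedArea, hw]; ring
  rw [h₁, f₁, abs_mul, abs_of_nonneg hc] at e₁
  rw [h₂, f₂, abs_mul, abs_of_nonneg ha] at e₂
  rw [h₃, f₃, abs_mul, abs_of_nonneg hb] at e₃
  linear_combination e₁ + e₂ + e₃

lemma signedArea_mul_nonpos_of_wOppSide {A B C D : EuclideanSpace ℝ (Fin 2)}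
    (h : (affineSpan ℝ ({A, C} : Set (EuclideanSpace ℝ (Fin 2)))).WOppSide B D) :
    signedArea A C B * signedArea A C D ≤ 0 := by
  obtain ⟨Y, hY, t, ⟨ht₀, ht₁⟩, rfl⟩ := AffineSubspace.wOppSide_iff_exists_wbtw.1 h
  obtain ⟨r, hr⟩ := exists_coord_of_mem_line hY
  have h₀ := hr 0
  have h₁ := hr 1
  simp only [AffineMap.lineMap_apply, vsub_eq_sub, vadd_eq_add, PiLp.add_apply, PiLp.smul_apply,
    PiLp.sub_apply, smul_eq_mul] at h₀ h₁
  have key : (1 - t) * signedArea A C B + t * signedArea A C D = 0 := by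
    simp only [signedArea]
    linear_combination (C 0 - A 0) * h₁ - (C 1 - A 1) * h₀
  generalize signedArea A C B = s at *
  generalize signedArea A C D = u at *
  by_contra! hsu
  rcases mul_pos_iff.1 hsu with ⟨hs, hu⟩ | ⟨hs, hu⟩ <;>
    rcases ht₁.lt_or_eq with ht | rfl <;> nlinarith

/-- Opposite angles of a cyclic quadrilateral are supplementary, in terms of cotangents. -/
lemma cospherical_inner_mul_signedArea {A B C D : EuclideanSpace ℝ (Fin 2)}
    (h : EuclideanGeometry.Cospherical ({A, B, C, D} : Set (EuclideanSpace ℝ (Fin 2)))) :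
    ((A 0 - B 0) * (C 0 - B 0) + (A 1 - B 1) * (C 1 - B 1)) * signedArea A C D =
      ((A 0 - D 0) * (C 0 - D 0) + (A 1 - D 1) * (C 1 - D 1)) * signedArea A C B := by
  obtain ⟨O, r, hr⟩ := h
  have key : ∀ P ∈ ({A, B, C, D} : Set (EuclideanSpace ℝ (Fin 2))),
      (P 0 - O 0) ^ 2 + (P 1 - O 1) ^ 2 = r ^ 2 := fun P hP => by
    rw [← dist_sq_eq_coord, hr P hP]
  have hA := key A (by simp)
  have hB := key B (by simp)
  have hC := key C (by simp)
  have hD := key D (by simp)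
  simp only [signedArea]
  linear_combination
    -((C 0 - B 0) * (D 1 - B 1) - (C 1 - B 1) * (D 0 - B 0)) * hA
    + ((C 0 - A 0) * (D 1 - A 1) - (C 1 - A 1) * (D 0 - A 0)) * hB
    - ((B 0 - A 0) * (D 1 - A 1) - (B 1 - A 1) * (D 0 - A 0)) * hC
    + ((B 0 - A 0) * (C 1 - A 1) - (B 1 - A 1) * (C 0 - A 0)) * hD

lemma mul_add_eq_of_supplementary {x y s t m n : ℝ} (hs : 0 < s) (ht : 0 < t) (hm : 0 ≤ m)
    (hn : 0 ≤ n) (hxm : m ^ 2 = x ^ 2 + s ^ 2) (hyn : n ^ 2 = y ^ 2 + t ^ 2)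
    (h : x * t + y * s = 0) : (m + x) * (n + y) = s * t := by
  have hmn : n * s = m * t := by
    rw [← sq_eq_sq₀ (by positivity) (by positivity)]
    linear_combination s ^ 2 * hyn - t ^ 2 * hxm + (y * s - x * t) * h
  apply mul_right_cancel₀ hs.ne'
  linear_combination (m + x) * hmn + (m + x) * h + t * hxm

/-- The law of cosines with the area, for the tangent length from `B`. -/
lemma perimeter_mul_tangent (A B C : EuclideanSpace ℝ (Fin 2)) :
    (dist A B + dist B C + dist A C) * (dist A B + dist B C - dist A C) =
      2 * (dist A B * dist B C + ((A 0 - B 0) * (C 0 - B 0) + (A 1 - B 1) * (C 1 - B 1))) := by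
  linear_combination dist_sq_eq_coord A B + dist_sq_eq_coord B C - dist_sq_eq_coord A C

lemma mul_dist_sq_eq (A B C : EuclideanSpace ℝ (Fin 2)) :
    (dist A B * dist B C) ^ 2 =
      ((A 0 - B 0) * (C 0 - B 0) + (A 1 - B 1) * (C 1 - B 1)) ^ 2 + |signedArea A C B| ^ 2 := by
  rw [mul_pow, dist_sq_eq_coord, dist_sq_eq_coord, sq_abs, signedArea]
  ring

/-- In a convex cyclic quadrilateral `ABCD`, the product of the inradii of the
triangles `ABC` and `ACD` equals the product of the tangent lengths from `B`
in `ABC` and from `D` in `ACD`. -/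
theorem inradii_product_cyclic_quadrilateral
    (A B C D : EuclideanSpace ℝ (Fin 2))
    (hdist : A ≠ B ∧ A ≠ C ∧ A ≠ D ∧ B ≠ C ∧ B ≠ D ∧ C ≠ D)
    (hcyclic : EuclideanGeometry.Cospherical ({A, B, C, D} : Set (EuclideanSpace ℝ (Fin 2))))
    (hBD : (affineSpan ℝ ({A, C} : Set (EuclideanSpace ℝ (Fin 2)))).SOppSide B D)
    (hAC : (affineSpan ℝ ({B, D} : Set (EuclideanSpace ℝ (Fin 2)))).SOppSide A C)
    (R₁ R₂ : ℝ) (hR₁ : 0 < R₁) (hR₂ : 0 < R₂)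
    (hin₁ : ∃ I ∈ interior (convexHull ℝ ({A, B, C} : Set (EuclideanSpace ℝ (Fin 2)))),
      infDist I (affineSpan ℝ ({A, B} : Set (EuclideanSpace ℝ (Fin 2))) : Set (EuclideanSpace ℝ (Fin 2))) = R₁ ∧
      infDist I (affineSpan ℝ ({B, C} : Set (EuclideanSpace ℝ (Fin 2))) : Set (EuclideanSpace ℝ (Fin 2))) = R₁ ∧
      infDist I (affineSpan ℝ ({C, A} : Set (EuclideanSpace ℝ (Fin 2))) : Set (EuclideanSpace ℝ (Fin 2))) = R₁)
    (hin₂ : ∃ I ∈ interior (convexHull ℝ ({A, C, D} : Set (EuclideanSpace ℝ (Fin 2)))),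
      infDist I (affineSpan ℝ ({A, C} : Set (EuclideanSpace ℝ (Fin 2))) : Set (EuclideanSpace ℝ (Fin 2))) = R₂ ∧
      infDist I (affineSpan ℝ ({C, D} : Set (EuclideanSpace ℝ (Fin 2))) : Set (EuclideanSpace ℝ (Fin 2))) = R₂ ∧
      infDist I (affineSpan ℝ ({D, A} : Set (EuclideanSpace ℝ (Fin 2))) : Set (EuclideanSpace ℝ (Fin 2))) = R₂) :
    R₁ * R₂ = ((dist A B + dist B C + dist C A) / 2 - dist A C)
              * ((dist A C + dist C D + dist D A) / 2 - dist A C) := by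
  obtain ⟨hAB, hAC', hAD, hBC, -, hCD⟩ := hdist
  obtain ⟨I, hI, i₁, i₂, i₃⟩ := hin₁
  obtain ⟨J, hJ, j₁, j₂, j₃⟩ := hin₂
  have e₁ := inradius_mul_perimeter hAB hBC hAC'.symm (interior_subset hI) i₁ i₂ i₃
  have e₂ := inradius_mul_perimeter hAC' hCD hAD.symm (interior_subset hJ) j₁ j₂ j₃
  have hswap : signedArea A B C = -signedArea A C B := by
    simp only [signedArea]; ring
  rw [hswap, abs_neg, dist_comm C A] at e₁
  rw [dist_comm C D, dist_comm D A] at e₂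
  rw [dist_comm C A, dist_comm C D, dist_comm D A]
  have hb : 0 < dist A C := dist_pos.2 hAC'
  have hp₁ : 0 < dist A B + dist B C + dist A C := by positivity
  have hp₂ : 0 < dist A C + dist D C + dist A D := by positivity
  have hs : 0 < |signedArea A C B| := e₁ ▸ mul_pos hR₁ hp₁
  have ht : 0 < |signedArea A C D| := e₂ ▸ mul_pos hR₂ hp₂
  have hopp := signedArea_mul_nonpos_of_wOppSide hBD.wOppSide
  have hcot := cospherical_inner_mul_signedArea hcyclic
  have key := mul_add_eq_of_supplementary hs ht (by positivity) (by positivity)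
    (mul_dist_sq_eq A B C) (mul_dist_sq_eq A D C) (by
      rcases (abs_pos.1 hs).lt_or_gt with h | h
      · have h' : 0 < signedArea A C D := by
          rcases (abs_pos.1 ht).lt_or_gt with h' | h'
          · nlinarith
          · exact h'
        rw [abs_of_neg h, abs_of_pos h']
        linear_combination hcot
      · have h' : signedArea A C D < 0 := by
          rcases (abs_pos.1 ht).lt_or_gt with h' | h'
          · exact h'
          · nlinarith
        rw [abs_of_pos h, abs_of_neg h']
        linear_combination -hcot)
  have t₁ := perimeter_mul_tangent A B C
  have t₂ := perimeter_mul_tangent A D C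
  rw [← e₁, ← e₂] at key
  apply mul_right_cancel₀ (mul_pos hp₁ hp₂).ne'
  set x := (A 0 - B 0) * (C 0 - B 0) + (A 1 - B 1) * (C 1 - B 1)
  set y := (A 0 - D 0) * (C 0 - D 0) + (A 1 - D 1) * (C 1 - D 1)
  linear_combination -key
    - (dist A D + dist D C + dist A C) * (dist A D + dist D C - dist A C) / 4 * t₁
    - (dist A B * dist B C + x) / 2 * t₂
end

section
/- Let A, B, C, D be four distinct concyclic points in the Euclidean plane ℝ² forming a convex cyclic quadrilateral in this order, so that the triangles ABC and ACD are inscribed in the same circle and share the edge AC. Let p₁, p₂ be the semiperimeters of ABC and ACD, and set s₁ = p₁ − dist B C, t₁ = p₁ − dist A B (the lengths of the two segments into which the incircle of ABC splits AC, measured from A and from C), and s₂ = p₂ − dist C D, t₂ = p₂ − dist A D (the analogous lengths for the incircle of ACD). Then area(ABC) · area(ACD) = s₁ · t₁ · s₂ · t₂. -/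
open Real EuclideanGeometry Metric MeasureTheory
open scoped Pointwise

/-- The solid right triangle with unit legs has area `1 / 2`. -/
lemma volume_prod_unit_triangle :
    volume {p : ℝ × ℝ | 0 ≤ p.1 ∧ 0 ≤ p.2 ∧ p.1 + p.2 ≤ 1} = ENNReal.ofReal (1 / 2) := by
  have hclosed : IsClosed {p : ℝ × ℝ | 0 ≤ p.1 ∧ 0 ≤ p.2 ∧ p.1 + p.2 ≤ 1} :=
    (isClosed_le continuous_const continuous_fst).inter
      ((isClosed_le continuous_const continuous_snd).inter
        (isClosed_le (continuous_fst.add continuous_snd) continuous_const))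
  have hslice (x : ℝ) :
      volume (Prod.mk x ⁻¹' {p : ℝ × ℝ | 0 ≤ p.1 ∧ 0 ≤ p.2 ∧ p.1 + p.2 ≤ 1}) =
        (Set.Icc (0 : ℝ) 1).indicator (fun x ↦ ENNReal.ofReal (1 - x)) x := by
    by_cases hx : x ∈ Set.Icc (0 : ℝ) 1
    · rw [Set.indicator_of_mem hx, ← sub_zero (1 - x), ← Real.volume_Icc]
      congr 1
      ext y
      have := hx.1
      simp only [Set.mem_preimage, Set.mem_ofPred_eq, Set.mem_Icc]
      constructor
      · rintro ⟨-, h, h'⟩; exact ⟨h, by linarith⟩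
      · rintro ⟨h, h'⟩; exact ⟨this, h, by linarith⟩
    · rw [Set.indicator_of_notMem hx]
      convert measure_empty (μ := volume)
      ext y
      simp only [Set.mem_preimage, Set.mem_ofPred_eq, Set.mem_empty_iff_false, iff_false]
      rintro ⟨h, h', h''⟩
      exact hx ⟨h, by linarith⟩
  rw [Measure.volume_eq_prod, Measure.prod_apply hclosed.measurableSet]
  simp_rw [hslice]
  rw [lintegral_indicator measurableSet_Icc, ← ofReal_integral_eq_lintegral_ofReal,
    integral_Icc_eq_integral_Ioc, ← intervalIntegral.integral_of_le zero_le_one]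
  · rw [intervalIntegral.integral_sub (by simp) (by simp)]
    norm_num
  · exact (continuous_const.sub continuous_id).integrableOn_Icc
  · filter_upwards [ae_restrict_mem measurableSet_Icc] with x hx
    simpa using hx.2

/-- The convex hull of the origin and the two coordinate unit points, described by inequalities. -/
lemma convexHull_zero_unit_points :
    convexHull ℝ ({0, !₂[1, 0], !₂[0, 1]} : Set (EuclideanSpace ℝ (Fin 2))) =
      {x | 0 ≤ x 0 ∧ 0 ≤ x 1 ∧ x 0 + x 1 ≤ 1} := by
  apply Set.Subset.antisymm
  · refine convexHull_min ?_ ?_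
    · rintro x (rfl | rfl | rfl) <;> norm_num
    · rintro x ⟨hx₀, hx₁, hx⟩ y ⟨hy₀, hy₁, hy⟩ a b ha hb hab
      simp only [Set.mem_ofPred_eq, PiLp.add_apply, PiLp.smul_apply, smul_eq_mul]
      exact ⟨by positivity, by positivity, by nlinarith⟩
  · rintro x ⟨hx₀, hx₁, hx⟩
    refine mem_convexHull_of_exists_fintype ![1 - x 0 - x 1, x 0, x 1]
      ![0, !₂[1, 0], !₂[0, 1]] ?_ ?_ ?_ ?_
    · intro i; fin_cases i <;> simp <;> linarith
    · simp [Fin.sum_univ_three]; ring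
    · intro i; fin_cases i <;> simp
    · ext i; fin_cases i <;> simp [Fin.sum_univ_three]

lemma volume_convexHull_zero_unit_points :
    volume (convexHull ℝ ({0, !₂[1, 0], !₂[0, 1]} : Set (EuclideanSpace ℝ (Fin 2)))) =
      ENNReal.ofReal (1 / 2) := by
  have hmp := (volume_preserving_finTwoArrow ℝ).comp (PiLp.volume_preserving_ofLp (Fin 2))
  rw [convexHull_zero_unit_points, ← volume_prod_unit_triangle, ← hmp.measure_preimage]
  · rfl
  · refine MeasurableSet.nullMeasurableSet (IsClosed.measurableSet ?_)
    exact (isClosed_le continuous_const continuous_fst).inter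
      ((isClosed_le continuous_const continuous_snd).inter
        (isClosed_le (continuous_fst.add continuous_snd) continuous_const))

/-- The cross product of the vectors from `B` to `A` and from `B` to `C`. -/
def planeCross (A B C : EuclideanSpace ℝ (Fin 2)) : ℝ :=
  (A 0 - B 0) * (C 1 - B 1) - (A 1 - B 1) * (C 0 - B 0)

/-- The area of a plane triangle is half the absolute value of the cross product of two sides. -/
lemma volume_convexHull_triangle (A B C : EuclideanSpace ℝ (Fin 2)) :
    (volume (convexHull ℝ ({A, B, C} : Set (EuclideanSpace ℝ (Fin 2))))).toReal =
      |planeCross A B C| / 2 := by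
  let b := (EuclideanSpace.basisFun (Fin 2) ℝ).toBasis
  let L : EuclideanSpace ℝ (Fin 2) →ₗ[ℝ] EuclideanSpace ℝ (Fin 2) :=
    Matrix.toLin b b !![A 0 - B 0, C 0 - B 0; A 1 - B 1, C 1 - B 1]
  have hL (x : EuclideanSpace ℝ (Fin 2)) : L x = x 0 • (A - B) + x 1 • (C - B) := by
    ext i
    fin_cases i <;> simp [L, b, Matrix.toLin_apply, Matrix.mulVec, dotProduct,
      Fin.sum_univ_two] <;> ring
  have himage : convexHull ℝ ({A, B, C} : Set (EuclideanSpace ℝ (Fin 2))) =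
      (fun x ↦ B + x) '' (L '' convexHull ℝ {0, !₂[1, 0], !₂[0, 1]}) := by
    change _ = B +ᵥ L '' _
    rw [L.image_convexHull, ← convexHull_vadd, Set.insert_comm]
    simp [Set.image_insert_eq, hL, ← Set.image_vadd]
  rw [himage, Set.image_add_left, measure_preimage_add, Measure.addHaar_image_linearMap,
    volume_convexHull_zero_unit_points, LinearMap.det_toLin, Matrix.det_fin_two_of,
    ENNReal.toReal_mul, ENNReal.toReal_ofReal (abs_nonneg _), ENNReal.toReal_ofReal (by norm_num),
    planeCross, mul_comm (C 0 - B 0)]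
  ring

lemma exists_mem_Ioo_planeCross_eq_zero {A B C D : EuclideanSpace ℝ (Fin 2)}
    (h : (affineSpan ℝ ({A, C} : Set (EuclideanSpace ℝ (Fin 2)))).SOppSide B D) :
    ∃ t ∈ Set.Ioo (0 : ℝ) 1, (1 - t) * planeCross A B C + t * planeCross A D C = 0 := by
  obtain ⟨p, hp, hBD⟩ := h.exists_sbtw
  obtain ⟨⟨t, ht, rfl⟩, -⟩ := sbtw_iff_mem_image_Ioo_and_ne.1 hBD
  obtain ⟨r, hr⟩ := mem_affineSpan_pair_iff_exists_lineMap_eq.1 hp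
  refine ⟨t, ht, ?_⟩
  have h₀ := congr($hr 0)
  have h₁ := congr($hr 1)
  simp only [AffineMap.lineMap_apply, vsub_eq_sub, vadd_eq_add, PiLp.add_apply, PiLp.smul_apply,
    PiLp.sub_apply, smul_eq_mul] at h₀ h₁
  unfold planeCross
  linear_combination (C 1 - A 1) * h₀ - (C 0 - A 0) * h₁

lemma planeCross_ne_zero {A B C : EuclideanSpace ℝ (Fin 2)} (hAC : A ≠ C)
    (hB : B ∉ affineSpan ℝ ({A, C} : Set (EuclideanSpace ℝ (Fin 2)))) :
    planeCross A B C ≠ 0 := by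
  intro h
  apply hB
  have hd : (C 0 - A 0) ^ 2 + (C 1 - A 1) ^ 2 ≠ 0 := by
    intro hd
    apply hAC
    have h₀ : C 0 - A 0 = 0 := by nlinarith [sq_nonneg (C 0 - A 0), sq_nonneg (C 1 - A 1)]
    have h₁ : C 1 - A 1 = 0 := by nlinarith [sq_nonneg (C 0 - A 0), sq_nonneg (C 1 - A 1)]
    ext i
    fin_cases i
    · exact (sub_eq_zero.1 h₀).symm
    · exact (sub_eq_zero.1 h₁).symm
  refine mem_affineSpan_pair_iff_exists_lineMap_eq.2
    ⟨((B 0 - A 0) * (C 0 - A 0) + (B 1 - A 1) * (C 1 - A 1)) /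
      ((C 0 - A 0) ^ 2 + (C 1 - A 1) ^ 2), ?_⟩
  unfold planeCross at h
  ext i
  fin_cases i <;> simp [AffineMap.lineMap_apply] <;> field_simp
  · linear_combination (C 1 - A 1) * h
  · linear_combination -(C 0 - A 0) * h

/-- Two points strictly on opposite sides of `AC` span with it triangles of opposite orientation. -/
lemma planeCross_mul_planeCross_neg {A B C D : EuclideanSpace ℝ (Fin 2)} (hAC : A ≠ C)
    (h : (affineSpan ℝ ({A, C} : Set (EuclideanSpace ℝ (Fin 2)))).SOppSide B D) :
    planeCross A B C * planeCross A D C < 0 := by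
  obtain ⟨t, ⟨ht₀, ht₁⟩, ht⟩ := exists_mem_Ioo_planeCross_eq_zero h
  have hD : 0 < planeCross A D C ^ 2 := sq_pos_of_ne_zero (planeCross_ne_zero hAC h.2.2)
  have h' : (1 - t) * (planeCross A B C * planeCross A D C) = -(t * planeCross A D C ^ 2) := by
    linear_combination planeCross A D C * ht
  have : 0 < t * planeCross A D C ^ 2 := by positivity
  by_contra! hle
  nlinarith [mul_nonneg (sub_nonneg.2 ht₁.le) hle]

/-- The dot product of the vectors from `B` to `A` and from `B` to `C`. -/
def planeDot (A B C : EuclideanSpace ℝ (Fin 2)) : ℝ :=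
  (A 0 - B 0) * (C 0 - B 0) + (A 1 - B 1) * (C 1 - B 1)

/-- The diagonal `AC` of a cyclic quadrilateral is seen from `B` and `D` under angles with the same
cotangent. -/
lemma planeDot_mul_planeCross_eq {A B C D : EuclideanSpace ℝ (Fin 2)}
    (h : Cospherical ({A, B, C, D} : Set (EuclideanSpace ℝ (Fin 2)))) :
    planeDot A B C * planeCross A D C = planeDot A D C * planeCross A B C := by
  obtain ⟨O, R, hR⟩ := h
  have key (P : EuclideanSpace ℝ (Fin 2)) (hP : P ∈ ({A, B, C, D} : Set _)) :
      (P 0 - O 0) ^ 2 + (P 1 - O 1) ^ 2 = R ^ 2 := by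
    rw [← hR P hP, EuclideanSpace.dist_sq_eq, Fin.sum_univ_two, Real.dist_eq, Real.dist_eq, sq_abs,
      sq_abs]
  have hA := key A (by simp)
  have hB := key B (by simp)
  have hC := key C (by simp)
  have hD := key D (by simp)
  unfold planeDot planeCross
  linear_combination
    -((B 0 - D 0) * (C 1 - D 1) - (B 1 - D 1) * (C 0 - D 0)) * hA
    + ((A 0 - D 0) * (C 1 - D 1) - (A 1 - D 1) * (C 0 - D 0)) * hB
    - ((A 0 - D 0) * (B 1 - D 1) - (A 1 - D 1) * (B 0 - D 0)) * hC
    + ((A 0 - C 0) * (B 1 - C 1) - (A 1 - C 1) * (B 0 - C 0)) * hD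

lemma planeDot_sq_add_planeCross_sq (A B C : EuclideanSpace ℝ (Fin 2)) :
    planeDot A B C ^ 2 + planeCross A B C ^ 2 = (dist A B * dist B C) ^ 2 := by
  rw [mul_pow, dist_comm B C, EuclideanSpace.dist_sq_eq, EuclideanSpace.dist_sq_eq]
  simp only [Fin.sum_univ_two, Real.dist_eq, sq_abs, planeDot, planeCross]
  ring

/-- The product of the tangent lengths from `A` and `C`, through the law of cosines. -/
lemma tangent_length_mul_tangent_length (A B C : EuclideanSpace ℝ (Fin 2)) :
    ((dist A B + dist B C + dist C A) / 2 - dist B C) *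
      ((dist A B + dist B C + dist C A) / 2 - dist A B) =
      (dist A B * dist B C - planeDot A B C) / 2 := by
  have hlaw : dist C A ^ 2 = dist A B ^ 2 + dist B C ^ 2 - 2 * planeDot A B C := by
    simp only [EuclideanSpace.dist_sq_eq, Fin.sum_univ_two, Real.dist_eq, sq_abs, planeDot]
    ring
  linear_combination hlaw / 4

/-- If `(p, x)` and `(q, y)` are proportional vectors of norms `m` and `n`, with `x` and `y` of
opposite signs, then `|x| * |y| = (m - p) * (n - q)`. -/
lemma abs_mul_abs_eq_of_proportional {p q x y m n : ℝ} (hm : 0 ≤ m) (hn : 0 ≤ n)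
    (hpx : p ^ 2 + x ^ 2 = m ^ 2) (hqy : q ^ 2 + y ^ 2 = n ^ 2)
    (hprop : p * y = q * x) (hxy : x * y < 0) :
    |x| * |y| = (m - p) * (n - q) := by
  have hx : x ≠ 0 := by rintro rfl; simp at hxy
  obtain ⟨k, rfl⟩ : ∃ k, y = -k * x := ⟨-(y / x), by field_simp⟩
  have hk : 0 < k := by nlinarith [sq_pos_of_ne_zero hx]
  have hq : q = -k * p := mul_right_cancel₀ hx (by linear_combination -hprop)
  have hn' : n = k * m := by
    rw [← sq_eq_sq₀ hn (by positivity), ← hqy, hq]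
    linear_combination k ^ 2 * hpx
  rw [← abs_mul, abs_of_neg hxy, hn', hq]
  linear_combination k * hpx

/-- In a convex cyclic quadrilateral `ABCD`, the product of the areas of the
triangles `ABC` and `ACD` equals `s₁·t₁·s₂·t₂`, the product of the lengths of
the segments cut on the common edge `AC` by the two incircles. -/
theorem area_product_cyclic_quadrilateral_tangent
    (A B C D : EuclideanSpace ℝ (Fin 2))
    (hdist : A ≠ B ∧ A ≠ C ∧ A ≠ D ∧ B ≠ C ∧ B ≠ D ∧ C ≠ D)
    (hcyclic : EuclideanGeometry.Cospherical ({A, B, C, D} : Set (EuclideanSpace ℝ (Fin 2))))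
    (hBD : (affineSpan ℝ ({A, C} : Set (EuclideanSpace ℝ (Fin 2)))).SOppSide B D)
    (hAC : (affineSpan ℝ ({B, D} : Set (EuclideanSpace ℝ (Fin 2)))).SOppSide A C) :
    (volume (convexHull ℝ ({A, B, C} : Set (EuclideanSpace ℝ (Fin 2))))).toReal
      * (volume (convexHull ℝ ({A, C, D} : Set (EuclideanSpace ℝ (Fin 2))))).toReal
      = ((dist A B + dist B C + dist C A) / 2 - dist B C)
        * ((dist A B + dist B C + dist C A) / 2 - dist A B)
        * ((dist A C + dist C D + dist D A) / 2 - dist C D)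
        * ((dist A C + dist C D + dist D A) / 2 - dist A D) := by
  have hABC := tangent_length_mul_tangent_length A B C
  have hADC := tangent_length_mul_tangent_length A D C
  have hprod := abs_mul_abs_eq_of_proportional (by positivity) (by positivity)
    (planeDot_sq_add_planeCross_sq A B C) (planeDot_sq_add_planeCross_sq A D C)
    (planeDot_mul_planeCross_eq hcyclic) (planeCross_mul_planeCross_neg hdist.2.1 hBD)
  rw [Set.pair_comm C D, volume_convexHull_triangle, volume_convexHull_triangle, hABC]
  rw [dist_comm D C, dist_comm C A] at hADC
  rw [dist_comm D C] at hprod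
  rw [dist_comm D A]
  linear_combination hprod / 4 - (dist A B * dist B C - planeDot A B C) / 2 * hADC
end

section
/- Let n ≥ 1 and let Q₀, Q₁, …, Q_{n+1} be n+2 distinct points in the Euclidean plane ℝ² lying in this cyclic order on a common circle and in convex position. For j = 1, …, n let T_j be the triangle Q₀ Q_j Q_{j+1}, with semiperimeter p_j and area A_j, and set s_j = p_j − dist(Q_j, Q_{j+1}), r_j = p_j − dist(Q₀, Q_{j+1}), t_j = p_j − dist(Q₀, Q_j). Then for all 1 ≤ h < k ≤ n: A_h · A_k = s_h · t_h · s_k · r_k · ∏_{i=h+1}^{k−1} (s_i / p_i), where the empty product (when k = h+1) is 1. -/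
open Real EuclideanGeometry Metric MeasureTheory

lemma EuclideanSpace.volume_standard_triangle :
    volume {x : EuclideanSpace ℝ (Fin 2) | 0 ≤ x 0 ∧ 0 ≤ x 1 ∧ x 0 + x 1 ≤ 1} =
      ENNReal.ofReal (1 / 2) := by
  have hs : MeasurableSet {q : ℝ × ℝ | 0 ≤ q.1 ∧ 0 ≤ q.2 ∧ q.1 + q.2 ≤ 1} := by
    simp only [Set.ofPred_and]
    exact ((isClosed_le (by fun_prop) (by fun_prop)).inter ((isClosed_le (by fun_prop)
      (by fun_prop)).inter (isClosed_le (by fun_prop) (by fun_prop)))).measurableSet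
  have h := ((volume_preserving_finTwoArrow ℝ).comp
    (PiLp.volume_preserving_ofLp (Fin 2))).measure_preimage hs.nullMeasurableSet
  change volume ((MeasurableEquiv.finTwoArrow ∘ WithLp.ofLp) ⁻¹'
    {q : ℝ × ℝ | 0 ≤ q.1 ∧ 0 ≤ q.2 ∧ q.1 + q.2 ≤ 1}) = _
  rw [h, Measure.volume_eq_prod, Measure.prod_apply hs]
  have hx : ∀ x : ℝ, x ≠ 0 →
      volume (Prod.mk x ⁻¹' {q : ℝ × ℝ | 0 ≤ q.1 ∧ 0 ≤ q.2 ∧ q.1 + q.2 ≤ 1}) =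
        (Set.Ioc (0 : ℝ) 1).indicator (fun x => ENNReal.ofReal (1 - x)) x := by
    intro x h0
    by_cases hx : x ∈ Set.Ioc (0 : ℝ) 1
    · rw [Set.indicator_of_mem hx, ← sub_zero (1 - x), ← Real.volume_Icc]
      congr 1
      ext y
      simp only [Set.mem_preimage, Set.mem_ofPred_eq, Set.mem_Icc]
      constructor
      · rintro ⟨-, hy, hxy⟩
        exact ⟨hy, by linarith⟩
      · rintro ⟨hy, hxy⟩
        exact ⟨hx.1.le, hy, by linarith⟩
    · rw [Set.indicator_of_notMem hx]
      convert measure_empty (μ := volume)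
      ext y
      simp only [Set.mem_preimage, Set.mem_ofPred_eq, Set.mem_empty_iff_false, iff_false]
      rintro ⟨hx0, hy, hxy⟩
      exact hx ⟨lt_of_le_of_ne hx0 h0.symm, by linarith⟩
  rw [lintegral_congr_ae
      (g := (Set.Ioc (0 : ℝ) 1).indicator (fun x => ENNReal.ofReal (1 - x))),
    lintegral_indicator measurableSet_Ioc, ← ofReal_integral_eq_lintegral_ofReal,
    ← intervalIntegral.integral_of_le zero_le_one]
  · congr 1
    rw [intervalIntegral.integral_sub (by simp) (by simp)]
    norm_num
  · exact Continuous.integrableOn_Ioc (by fun_prop)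
  · exact (ae_restrict_iff' measurableSet_Ioc).2 (.of_forall fun x hx => by simpa using hx.2)
  · filter_upwards [Measure.ae_ne volume (0 : ℝ)] with x hx0
    exact hx x hx0

lemma EuclideanSpace.convexHull_triple_eq_image (a b c : EuclideanSpace ℝ (Fin 2)) :
    convexHull ℝ {a, b, c} = (fun y => a + y) ''
      (Matrix.toLpLin 2 2 !![b 0 - a 0, c 0 - a 0; b 1 - a 1, c 1 - a 1] ''
        {x : EuclideanSpace ℝ (Fin 2) | 0 ≤ x 0 ∧ 0 ≤ x 1 ∧ x 0 + x 1 ≤ 1}) := by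
  have key : ∀ x : EuclideanSpace ℝ (Fin 2),
      a + Matrix.toLpLin 2 2 !![b 0 - a 0, c 0 - a 0; b 1 - a 1, c 1 - a 1] x =
        (1 - x 0 - x 1) • a + (x 0 • b + x 1 • c) := by
    intro x
    ext i
    fin_cases i <;> simp [Matrix.toLpLin_apply, dotProduct, Fin.sum_univ_two] <;>
      ring
  ext z
  simp only [Set.image_image, Set.mem_image, Set.mem_ofPred_eq, key]
  constructor
  · rw [convexHull_insert (Set.insert_nonempty _ _), convexHull_pair]
    simp only [mem_convexJoin, Set.mem_singleton_iff, exists_eq_left]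
    rintro ⟨y, ⟨u, v, hu, hv, huv, rfl⟩, ⟨α, β, hα, hβ, hαβ, rfl⟩⟩
    have hβuv : β * u + β * v = β := by rw [← mul_add, huv, mul_one]
    refine ⟨!₂[β * u, β * v], ⟨?_, ?_, ?_⟩, ?_⟩
    · simpa using mul_nonneg hβ hu
    · simpa using mul_nonneg hβ hv
    · simp only [Matrix.cons_val_zero, Matrix.cons_val_one]
      linarith
    · have : 1 - β * u - β * v = α := by linarith
      simp [this, smul_smul]
  · rintro ⟨x, ⟨h0, h1, h2⟩, rfl⟩
    have hconv := convex_convexHull ℝ ({a, b, c} : Set (EuclideanSpace ℝ (Fin 2)))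
    have ha : a ∈ convexHull ℝ {a, b, c} := subset_convexHull ℝ _ (by simp)
    have hb : b ∈ convexHull ℝ {a, b, c} := subset_convexHull ℝ _ (by simp)
    have hc : c ∈ convexHull ℝ {a, b, c} := subset_convexHull ℝ _ (by simp)
    have := hconv.sum_mem (t := Finset.univ) (w := ![1 - x 0 - x 1, x 0, x 1]) (z := ![a, b, c])
      (by intro i _; fin_cases i <;> simp <;> linarith)
      (by simp only [Fin.sum_univ_three, Matrix.cons_val]; ring)
      (by intro i _; fin_cases i <;> simpa)
    simpa [Fin.sum_univ_three, add_assoc] using this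

/-- The shoelace formula for the area of a triangle. -/
lemma EuclideanSpace.volume_convexHull_triple (a b c : EuclideanSpace ℝ (Fin 2)) :
    (volume (convexHull ℝ {a, b, c})).toReal =
      |(b 0 - a 0) * (c 1 - a 1) - (c 0 - a 0) * (b 1 - a 1)| / 2 := by
  rw [EuclideanSpace.convexHull_triple_eq_image, Set.image_add_left, measure_preimage_add,
    Measure.addHaar_image_linearMap, EuclideanSpace.volume_standard_triangle,
    LinearMap.det_toLpLin, Matrix.det_fin_two_of, ENNReal.toReal_mul,
    ENNReal.toReal_ofReal (abs_nonneg _), ENNReal.toReal_ofReal (by norm_num)]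
  ring

/-- The length of a chord of a circle. -/
lemma dist_eq_of_polar {P Q O : EuclideanSpace ℝ (Fin 2)} {ρ α β : ℝ} (hρ : 0 ≤ ρ)
    (hP : P 0 = O 0 + ρ * cos α ∧ P 1 = O 1 + ρ * sin α)
    (hQ : Q 0 = O 0 + ρ * cos β ∧ Q 1 = O 1 + ρ * sin β)
    (h0 : α ≤ β) (h1 : β ≤ α + 2 * π) :
    dist P Q = 2 * ρ * sin ((β - α) / 2) := by
  have hsin : 0 ≤ sin ((β - α) / 2) := sin_nonneg_of_nonneg_of_le_pi (by linarith) (by linarith)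
  rw [EuclideanSpace.dist_eq, Fin.sum_univ_two, Real.dist_eq, Real.dist_eq, sq_abs, sq_abs,
    hP.1, hP.2, hQ.1, hQ.2, Real.sqrt_eq_iff_mul_self_eq (by positivity) (by positivity)]
  have h := Real.sin_sq_eq_half_sub ((β - α) / 2)
  rw [mul_div_cancel₀ _ two_ne_zero, Real.cos_sub] at h
  linear_combination ρ ^ 2 * Real.sin_sq_add_cos_sq α + ρ ^ 2 * Real.sin_sq_add_cos_sq β
    - 4 * ρ ^ 2 * h

/-- The area of a triangle inscribed in a circle. -/
lemma area_eq_of_polar {P Q R O : EuclideanSpace ℝ (Fin 2)} {ρ α x y : ℝ}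
    (hP : P 0 = O 0 + ρ * cos α ∧ P 1 = O 1 + ρ * sin α)
    (hQ : Q 0 = O 0 + ρ * cos (α + 2 * x) ∧ Q 1 = O 1 + ρ * sin (α + 2 * x))
    (hR : R 0 = O 0 + ρ * cos (α + 2 * y) ∧ R 1 = O 1 + ρ * sin (α + 2 * y))
    (hx : 0 ≤ x) (hxy : x ≤ y) (hy : y ≤ π) :
    (volume (convexHull ℝ {P, Q, R})).toReal = 2 * ρ ^ 2 * sin x * sin y * sin (y - x) := by
  have h1 : 0 ≤ sin x := sin_nonneg_of_nonneg_of_le_pi hx (by linarith)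
  have h2 : 0 ≤ sin y := sin_nonneg_of_nonneg_of_le_pi (by linarith) hy
  have h3 : 0 ≤ sin (y - x) := sin_nonneg_of_nonneg_of_le_pi (by linarith) (by linarith)
  have key : (Q 0 - P 0) * (R 1 - P 1) - (R 0 - P 0) * (Q 1 - P 1) =
      4 * ρ ^ 2 * sin x * sin y * sin (y - x) := by
    rw [hP.1, hP.2, hQ.1, hQ.2, hR.1, hR.2]
    simp only [cos_add, sin_add, cos_two_mul', sin_two_mul, sin_sub]
    have hα := Real.sin_sq_add_cos_sq α
    have hx := Real.sin_sq_add_cos_sq x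
    have hy := Real.sin_sq_add_cos_sq y
    grind
  rw [EuclideanSpace.volume_convexHull_triple, key, abs_of_nonneg (by positivity)]
  ring

/-- For the fan triangulation of a convex cyclic polygon, the product of the
areas of two of the triangles is given by
`A_h · A_k = s_h · t_h · s_k · r_k · ∏_{i=h+1}^{k-1} (s_i / p_i)`. -/
theorem cyclic_polygon_area_product_s
    (n : ℕ) (hn : 1 ≤ n)
    (Q : ℕ → EuclideanSpace ℝ (Fin 2))
    (O : EuclideanSpace ℝ (Fin 2)) (ρ : ℝ) (θ : ℕ → ℝ)
    (hρ : 0 < ρ)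
    (hθmem : ∀ i ≤ n + 1, θ i ∈ Set.Ico 0 (2 * π))
    (hθmono : StrictMonoOn θ (Set.Iic (n + 1)))
    (hQ : ∀ i ≤ n + 1,
      Q i 0 = O 0 + ρ * Real.cos (θ i) ∧ Q i 1 = O 1 + ρ * Real.sin (θ i))
    (hinj : ∀ i ≤ n + 1, ∀ j ≤ n + 1, Q i = Q j → i = j)
    (p s r t : ℕ → ℝ)
    (hp : ∀ j, 1 ≤ j → j ≤ n →
      p j = (dist (Q 0) (Q j) + dist (Q j) (Q (j + 1)) + dist (Q (j + 1)) (Q 0)) / 2)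
    (hs : ∀ j, 1 ≤ j → j ≤ n → s j = p j - dist (Q j) (Q (j + 1)))
    (hr : ∀ j, 1 ≤ j → j ≤ n → r j = p j - dist (Q 0) (Q (j + 1)))
    (ht : ∀ j, 1 ≤ j → j ≤ n → t j = p j - dist (Q 0) (Q j))
    (A : ℕ → ℝ)
    (hA : ∀ j, 1 ≤ j → j ≤ n →
      A j = (volume (convexHull ℝ
        ({Q 0, Q j, Q (j + 1)} : Set (EuclideanSpace ℝ (Fin 2))))).toReal) :
    ∀ h k, 1 ≤ h → h < k → k ≤ n →
      A h * A k = s h * t h * s k * r k * ∏ i ∈ Finset.Icc (h + 1) (k - 1), s i / p i := by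
  intro h k hh hhk hk
  have hθ : ∀ i j, i ≤ j → j ≤ n + 1 → θ i ≤ θ j ∧ θ j ≤ θ i + 2 * π := by
    intro i j hij hj
    refine ⟨hθmono.monotoneOn (Set.mem_Iic.2 (hij.trans hj)) (Set.mem_Iic.2 hj) hij, ?_⟩
    linarith [(hθmem i (hij.trans hj)).1, (hθmem j hj).2]
  have hdist : ∀ i j, i ≤ j → j ≤ n + 1 → dist (Q i) (Q j) = 2 * ρ * sin ((θ j - θ i) / 2) :=
    fun i j hij hj => dist_eq_of_polar hρ.le (hQ i (hij.trans hj)) (hQ j hj)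
      (hθ i j hij hj).1 (hθ i j hij hj).2
  obtain ⟨x, hx⟩ : ∃ x : ℕ → ℝ, ∀ j, θ j = θ 0 + 4 * x j :=
    ⟨fun j => (θ j - θ 0) / 4, fun j => by ring⟩
  have hxpos : ∀ j, 1 ≤ j → j ≤ n + 1 → 0 < sin (x j) ∧ 0 < cos (x j) := by
    intro j hj1 hj
    have h0 : θ 0 < θ j :=
      hθmono (Set.mem_Iic.2 (Nat.zero_le _)) (Set.mem_Iic.2 hj) (by omega)
    have h1 := (hθmem 0 (Nat.zero_le _)).1
    have h2 := (hθmem j hj).2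
    have h3 := hx j
    exact ⟨sin_pos_of_pos_of_lt_pi (by linarith) (by linarith),
      cos_pos_of_mem_Ioo ⟨by linarith, by linarith⟩⟩
  have hcospos : ∀ j, 1 ≤ j → j ≤ n → 0 < cos (x (j + 1) - x j) := by
    intro j hj1 hj
    have h1 := hθ j (j + 1) (by omega) (by omega)
    have h2 := hx j
    have h3 := hx (j + 1)
    have h4 := (hθmem j (by omega)).1
    have h5 := (hθmem (j + 1) (by omega)).2
    exact cos_pos_of_mem_Ioo ⟨by linarith [pi_pos], by linarith⟩
  have hd : ∀ j, 1 ≤ j → j ≤ n →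
      dist (Q 0) (Q j) = 2 * ρ * sin (2 * x j) ∧
      dist (Q 0) (Q (j + 1)) = 2 * ρ * sin (2 * x (j + 1)) ∧
      dist (Q j) (Q (j + 1)) = 2 * ρ * sin (2 * (x (j + 1) - x j)) := by
    intro j hj1 hj
    rw [hdist 0 j (by omega) (by omega), hdist 0 (j + 1) (by omega) (by omega),
      hdist j (j + 1) (by omega) (by omega), hx j, hx (j + 1)]
    refine ⟨?_, ?_, ?_⟩ <;> ring_nf
  have htrig : ∀ j, 1 ≤ j → j ≤ n →
      p j = 4 * ρ * cos (x (j + 1) - x j) * sin (x (j + 1)) * cos (x j) ∧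
      s j = 4 * ρ * cos (x (j + 1) - x j) * cos (x (j + 1)) * sin (x j) ∧
      t j = 4 * ρ * sin (x (j + 1) - x j) * cos (x (j + 1)) * cos (x j) ∧
      r j = 4 * ρ * sin (x (j + 1) - x j) * sin (x (j + 1)) * sin (x j) := by
    intro j hj1 hj
    obtain ⟨h1, h2, h3⟩ := hd j hj1 hj
    have hu := Real.sin_sq_add_cos_sq (x j)
    have hv := Real.sin_sq_add_cos_sq (x (j + 1))
    rw [hs j hj1 hj, ht j hj1 hj, hr j hj1 hj, hp j hj1 hj, dist_comm (Q (j + 1)) (Q 0),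
      h1, h2, h3]
    simp only [sin_two_mul, sin_sub, cos_sub]
    generalize sin (x j) = a at *
    generalize cos (x j) = b at *
    generalize sin (x (j + 1)) = c at *
    generalize cos (x (j + 1)) = d at *
    refine ⟨?_, ?_, ?_, ?_⟩ <;> grind
  have hArea : ∀ j, 1 ≤ j → j ≤ n →
      A j = 2 * ρ ^ 2 * sin (2 * x j) * sin (2 * x (j + 1)) * sin (2 * (x (j + 1) - x j)) := by
    intro j hj1 hj
    have h1 := hθ j (j + 1) (by omega) (by omega)
    have h2 := hθ 0 j (by omega) (by omega)
    have h3 := hθ 0 (j + 1) (by omega) (by omega)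
    have hQj := hQ j (by omega)
    have hQj1 := hQ (j + 1) (by omega)
    rw [hx j] at h1 h2 hQj
    rw [hx (j + 1)] at h1 h3 hQj1
    rw [hA j hj1 hj, area_eq_of_polar (x := 2 * x j) (y := 2 * x (j + 1)) (hQ 0 (by omega))
      (by convert hQj using 4 <;> ring_nf) (by convert hQj1 using 4 <;> ring_nf)
      (by linarith) (by linarith) (by linarith), mul_sub]
  have hprod : ∀ m, h + 1 + m ≤ n → ∏ i ∈ Finset.Icc (h + 1) (h + m), s i / p i =
      tan (x (h + 1)) / tan (x (h + 1 + m)) := by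
    intro m
    induction m with
    | zero =>
      intro hm
      obtain ⟨h1, h2⟩ := hxpos (h + 1) (by omega) (by omega)
      rw [Finset.Icc_eq_empty (by omega), Finset.prod_empty, add_zero, tan_eq_sin_div_cos,
        div_self (by positivity)]
    | succ m ih =>
      intro hm
      rw [← add_assoc, Finset.prod_Icc_succ_top (by omega), ih (by omega),
        show h + m + 1 = h + 1 + m by ring, ← add_assoc]
      obtain ⟨h1, h2, -⟩ := htrig (h + 1 + m) (by omega) (by omega)
      obtain ⟨h3, h4⟩ := hxpos (h + 1 + m) (by omega) (by omega)
      obtain ⟨h5, h6⟩ := hxpos (h + 1 + m + 1) (by omega) (by omega)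
      have h7 := hcospos (h + 1 + m) (by omega) (by omega)
      rw [h1, h2]
      simp only [tan_eq_sin_div_cos]
      field_simp
  obtain ⟨m, rfl⟩ : ∃ m, k = h + 1 + m := ⟨k - (h + 1), by omega⟩
  rw [show h + 1 + m - 1 = h + m by omega, hprod m hk, hArea h hh (by omega),
    hArea (h + 1 + m) (by omega) hk]
  obtain ⟨-, h1, h2, -⟩ := htrig h hh (by omega)
  obtain ⟨-, h3, -, h4⟩ := htrig (h + 1 + m) (by omega) hk
  obtain ⟨h5, h6⟩ := hxpos (h + 1) (by omega) (by omega)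
  obtain ⟨h7, h8⟩ := hxpos (h + 1 + m) (by omega) (by omega)
  rw [h1, h2, h3, h4]
  simp only [sin_two_mul, tan_eq_sin_div_cos]
  field_simp
  ring
end

section
/- Let n ≥ 1 and let Q₀, Q₁, …, Q_{n+1} be n+2 distinct points in the Euclidean plane ℝ² lying in this cyclic order on a common circle and in convex position. For j = 1, …, n let T_j be the triangle Q₀ Q_j Q_{j+1}, with semiperimeter p_j and area A_j, and set s_j = p_j − dist(Q_j, Q_{j+1}), r_j = p_j − dist(Q₀, Q_{j+1}), t_j = p_j − dist(Q₀, Q_j). Then for all 1 ≤ h < k ≤ n: A_h · A_k = p_h · r_h · p_k · t_k · ∏_{i=h+1}^{k−1} (p_i / s_i), where the empty product (when k = h+1) is 1. -/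
open Real EuclideanGeometry Metric MeasureTheory

/-- The right triangle with legs on the coordinate axes and unit legs has area `1 / 2`. -/
lemma volume_unit_right_triangle :
    volume {x : Fin 2 → ℝ | 0 ≤ x 0 ∧ 0 ≤ x 1 ∧ x 0 + x 1 ≤ 1} = ENNReal.ofReal (1 / 2) := by
  set S : Set (ℝ × ℝ) := {z | 0 ≤ z.1 ∧ 0 ≤ z.2 ∧ z.1 + z.2 ≤ 1} with hS
  have hmeas : MeasurableSet S := by
    apply IsClosed.measurableSet
    exact (isClosed_le continuous_const continuous_fst).inter
      ((isClosed_le continuous_const continuous_snd).inter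
        (isClosed_le (continuous_fst.add continuous_snd) continuous_const))
  have hpre : {x : Fin 2 → ℝ | 0 ≤ x 0 ∧ 0 ≤ x 1 ∧ x 0 + x 1 ≤ 1} =
      MeasurableEquiv.finTwoArrow ⁻¹' S := by
    ext x
    simp [hS, MeasurableEquiv.finTwoArrow]
  have hslice : ∀ x : ℝ, volume (Prod.mk x ⁻¹' S) =
      (Set.Icc (0 : ℝ) 1).indicator (fun x => ENNReal.ofReal (1 - x)) x := by
    intro x
    by_cases hx : x ∈ Set.Icc (0 : ℝ) 1
    · have : Prod.mk x ⁻¹' S = Set.Icc 0 (1 - x) := by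
        ext y
        simp only [hS, Set.mem_preimage, Set.mem_ofPred_eq, Set.mem_Icc]
        constructor
        · rintro ⟨_, h2, h3⟩
          exact ⟨h2, by linarith⟩
        · rintro ⟨h2, h3⟩
          exact ⟨hx.1, h2, by linarith⟩
      rw [this, Set.indicator_of_mem hx, Real.volume_Icc, sub_zero]
    · have : Prod.mk x ⁻¹' S = ∅ := by
        ext y
        simp only [hS, Set.mem_preimage, Set.mem_ofPred_eq, Set.mem_empty_iff_false, iff_false]
        rintro ⟨h1, h2, h3⟩
        exact hx ⟨h1, by linarith⟩
      rw [this, Set.indicator_of_notMem hx, measure_empty]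
  rw [hpre, (volume_preserving_finTwoArrow ℝ).measure_preimage hmeas.nullMeasurableSet,
    Measure.volume_eq_prod, Measure.prod_apply hmeas]
  simp_rw [hslice]
  rw [lintegral_indicator measurableSet_Icc, ← ofReal_integral_eq_lintegral_ofReal,
    integral_Icc_eq_integral_Ioc, ← intervalIntegral.integral_of_le zero_le_one]
  · congr 1
    rw [intervalIntegral.integral_sub (by simp) (by simp)]
    simp
    norm_num
  · exact (continuous_const.sub continuous_id).continuousOn.integrableOn_Icc
  · exact (ae_restrict_iff' measurableSet_Icc).mpr
      (Filter.Eventually.of_forall fun x hx => by simpa using hx.2)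

/-- A point lies in a triangle iff it is the first vertex plus a combination of the two edges from
it with nonnegative coefficients of sum at most one. -/
lemma mem_convexHull_triple {E : Type*} [AddCommGroup E] [Module ℝ E] {a b c z : E} :
    z ∈ convexHull ℝ ({a, b, c} : Set E) ↔
      ∃ x y : ℝ, 0 ≤ x ∧ 0 ≤ y ∧ x + y ≤ 1 ∧ z = a + (x • (b - a) + y • (c - a)) := by
  constructor
  · rw [convexHull_insert (Set.insert_nonempty _ _), convexHull_pair, mem_convexJoin]
    rintro ⟨a', rfl, w, ⟨u, v, hu, hv, huv, rfl⟩, u', v', hu', hv', huv', rfl⟩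
    refine ⟨v' * u, v' * v, by positivity, by positivity, ?_, ?_⟩
    · rw [← mul_add, huv]
      linarith
    · obtain rfl : u' = 1 - v' := by linarith
      obtain rfl : u = 1 - v := by linarith
      module
  · rintro ⟨x, y, hx, hy, hxy, rfl⟩
    have hconv := convex_convexHull ℝ ({a, b, c} : Set E)
    have hsub := subset_convexHull ℝ ({a, b, c} : Set E)
    have h := hconv.sum_mem (t := Finset.univ) (w := ![1 - x - y, x, y]) (z := ![a, b, c])
      (by intro i _; fin_cases i <;> simp <;> linarith)
      (by simp only [Fin.sum_univ_three, Matrix.cons_val]; ring)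
      (by intro i _; fin_cases i <;> exact hsub (by simp))
    convert h using 1
    simp only [Fin.sum_univ_three, Matrix.cons_val]
    module

/-- The area of a triangle in the plane in terms of the coordinates of its vertices. -/
lemma volume_toReal_convexHull_triple (a b c : EuclideanSpace ℝ (Fin 2)) :
    (volume (convexHull ℝ ({a, b, c} : Set (EuclideanSpace ℝ (Fin 2))))).toReal =
      |(b 0 - a 0) * (c 1 - a 1) - (c 0 - a 0) * (b 1 - a 1)| / 2 := by
  set M : Matrix (Fin 2) (Fin 2) ℝ := !![b 0 - a 0, c 0 - a 0; b 1 - a 1, c 1 - a 1] with hM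
  set S : Set (Fin 2 → ℝ) := {x | 0 ≤ x 0 ∧ 0 ≤ x 1 ∧ x 0 + x 1 ≤ 1} with hS
  have himage : WithLp.toLp 2 ⁻¹' (convexHull ℝ ({a, b, c} : Set (EuclideanSpace ℝ (Fin 2)))) =
      (fun z => WithLp.ofLp a + z) '' (Matrix.toLin' M '' S) := by
    ext z
    rw [Set.mem_preimage, mem_convexHull_triple, Set.image_image]
    constructor
    · rintro ⟨x, y, hx, hy, hxy, h⟩
      refine ⟨![x, y], ⟨hx, hy, hxy⟩, ?_⟩
      have h' := congrArg WithLp.ofLp h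
      simp only at h'
      rw [h']
      ext i
      fin_cases i <;> simp [hM]
    · rintro ⟨w, ⟨hx, hy, hxy⟩, rfl⟩
      refine ⟨w 0, w 1, hx, hy, hxy, ?_⟩
      ext i
      fin_cases i <;> simp [hM, Matrix.vecHead, Matrix.vecTail] <;> ring
  have hclosed : IsClosed (convexHull ℝ ({a, b, c} : Set (EuclideanSpace ℝ (Fin 2)))) :=
    (Set.toFinite _).isClosed_convexHull ℝ
  rw [← (PiLp.volume_preserving_toLp (Fin 2)).measure_preimage
      hclosed.measurableSet.nullMeasurableSet, himage, Set.image_add_left,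
    measure_preimage_add, Measure.addHaar_image_linearMap, LinearMap.det_toLin',
    volume_unit_right_triangle, ← ENNReal.ofReal_mul (abs_nonneg _),
    ENNReal.toReal_ofReal (by positivity), hM, Matrix.det_fin_two_of]
  ring_nf

lemma cos_two_mul_sub_cos_two_mul (x y : ℝ) :
    cos (2 * y) - cos (2 * x) = -(2 * sin (y + x) * sin (y - x)) := by
  rw [cos_sub_cos]
  ring_nf

lemma sin_two_mul_sub_sin_two_mul (x y : ℝ) :
    sin (2 * y) - sin (2 * x) = 2 * cos (y + x) * sin (y - x) := by
  rw [sin_sub_sin]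
  ring_nf

/-- The length of a chord of a circle in terms of the arguments of its endpoints. -/
lemma dist_eq_two_mul_sin_half {X Y O : EuclideanSpace ℝ (Fin 2)} {ρ x y : ℝ} (hρ : 0 < ρ)
    (hX : X 0 = O 0 + ρ * cos (2 * x) ∧ X 1 = O 1 + ρ * sin (2 * x))
    (hY : Y 0 = O 0 + ρ * cos (2 * y) ∧ Y 1 = O 1 + ρ * sin (2 * y))
    (hxy : x ≤ y) (hyx : y ≤ x + π) :
    dist X Y = 2 * ρ * sin (y - x) := by
  have hsin : 0 ≤ sin (y - x) := sin_nonneg_of_nonneg_of_le_pi (by linarith) (by linarith)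
  have h0 : Y 0 - X 0 = ρ * -(2 * sin (y + x) * sin (y - x)) := by
    rw [hX.1, hY.1, ← cos_two_mul_sub_cos_two_mul]
    ring
  have h1 : Y 1 - X 1 = ρ * (2 * cos (y + x) * sin (y - x)) := by
    rw [hX.2, hY.2, ← sin_two_mul_sub_sin_two_mul]
    ring
  rw [dist_comm, EuclideanSpace.dist_eq, Fin.sum_univ_two, Real.dist_eq, Real.dist_eq, sq_abs,
    sq_abs, h0, h1, ← Real.sqrt_sq (show 0 ≤ 2 * ρ * sin (y - x) by positivity)]
  congr 1
  linear_combination (4 * ρ ^ 2 * sin (y - x) ^ 2) * sin_sq_add_cos_sq (y + x)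

/-- The area of a triangle inscribed in a circle in terms of the arguments of its vertices. -/
lemma volume_toReal_convexHull_inscribed {X Y Z O : EuclideanSpace ℝ (Fin 2)} {ρ x y z : ℝ}
    (hX : X 0 = O 0 + ρ * cos (2 * x) ∧ X 1 = O 1 + ρ * sin (2 * x))
    (hY : Y 0 = O 0 + ρ * cos (2 * y) ∧ Y 1 = O 1 + ρ * sin (2 * y))
    (hZ : Z 0 = O 0 + ρ * cos (2 * z) ∧ Z 1 = O 1 + ρ * sin (2 * z))
    (hxy : x ≤ y) (hyz : y ≤ z) (hzx : z ≤ x + π) :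
    (volume (convexHull ℝ ({X, Y, Z} : Set (EuclideanSpace ℝ (Fin 2))))).toReal =
      2 * ρ ^ 2 * sin (y - x) * sin (z - x) * sin (z - y) := by
  have hyx' : 0 ≤ sin (y - x) := sin_nonneg_of_nonneg_of_le_pi (by linarith) (by linarith)
  have hzx' : 0 ≤ sin (z - x) := sin_nonneg_of_nonneg_of_le_pi (by linarith) (by linarith)
  have hzy' : 0 ≤ sin (z - y) := sin_nonneg_of_nonneg_of_le_pi (by linarith) (by linarith)
  have hsub : sin (z - y) = sin (z + x) * cos (y + x) - cos (z + x) * sin (y + x) := by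
    rw [← sin_sub]
    ring_nf
  have hdet : (Y 0 - X 0) * (Z 1 - X 1) - (Z 0 - X 0) * (Y 1 - X 1) =
      4 * ρ ^ 2 * sin (y - x) * sin (z - x) * sin (z - y) := by
    have hy0 := cos_two_mul_sub_cos_two_mul x y
    have hy1 := sin_two_mul_sub_sin_two_mul x y
    have hz0 := cos_two_mul_sub_cos_two_mul x z
    have hz1 := sin_two_mul_sub_sin_two_mul x z
    rw [hX.1, hX.2, hY.1, hY.2, hZ.1, hZ.2, hsub]
    calc _ = ρ ^ 2 * ((cos (2 * y) - cos (2 * x)) * (sin (2 * z) - sin (2 * x)) -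
          (cos (2 * z) - cos (2 * x)) * (sin (2 * y) - sin (2 * x))) := by ring
      _ = _ := by
        rw [hy0, hy1, hz0, hz1]
        ring
  rw [volume_toReal_convexHull_triple, hdet, abs_of_nonneg (by positivity)]
  ring

/-- Semiperimeter, tangent lengths and area of a triangle inscribed in a circle, related through
the tangents of half of its angles at the second and third vertex. -/
lemma inscribed_triangle_relations {X Y Z O : EuclideanSpace ℝ (Fin 2)} {ρ x y z p A : ℝ}
    (hρ : 0 < ρ)
    (hX : X 0 = O 0 + ρ * cos x ∧ X 1 = O 1 + ρ * sin x)
    (hY : Y 0 = O 0 + ρ * cos y ∧ Y 1 = O 1 + ρ * sin y)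
    (hZ : Z 0 = O 0 + ρ * cos z ∧ Z 1 = O 1 + ρ * sin z)
    (hxy : x < y) (hyz : y < z) (hzx : z < x + 2 * π)
    (hp : p = (dist X Y + dist Y Z + dist Z X) / 2)
    (hA : A = (volume (convexHull ℝ ({X, Y, Z} : Set (EuclideanSpace ℝ (Fin 2))))).toReal) :
    p * (p - dist X Z) = A * tan ((z - x) / 4) ∧
      p * (p - dist X Y) = A / tan ((y - x) / 4) ∧
      p / (p - dist Y Z) = tan ((z - x) / 4) / tan ((y - x) / 4) := by
  set u := (y - x) / 4 with hu
  set v := (z - x) / 4 with hv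
  have hX' : X 0 = O 0 + ρ * cos (2 * (x / 2)) ∧ X 1 = O 1 + ρ * sin (2 * (x / 2)) := by
    rwa [mul_div_cancel₀ x two_ne_zero]
  have hY' : Y 0 = O 0 + ρ * cos (2 * (y / 2)) ∧ Y 1 = O 1 + ρ * sin (2 * (y / 2)) := by
    rwa [mul_div_cancel₀ y two_ne_zero]
  have hZ' : Z 0 = O 0 + ρ * cos (2 * (z / 2)) ∧ Z 1 = O 1 + ρ * sin (2 * (z / 2)) := by
    rwa [mul_div_cancel₀ z two_ne_zero]
  have hXY := dist_eq_two_mul_sin_half hρ hX' hY' (by linarith) (by linarith)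
  have hYZ := dist_eq_two_mul_sin_half hρ hY' hZ' (by linarith) (by linarith)
  have hXZ := dist_eq_two_mul_sin_half hρ hX' hZ' (by linarith) (by linarith)
  rw [volume_toReal_convexHull_inscribed hX' hY' hZ' (by linarith) (by linarith)
    (by linarith)] at hA
  rw [show y / 2 - x / 2 = 2 * u by rw [hu]; ring, sin_two_mul] at hXY hA
  rw [show z / 2 - x / 2 = 2 * v by rw [hv]; ring, sin_two_mul] at hXZ hA
  rw [show z / 2 - y / 2 = 2 * (v - u) by rw [hu, hv]; ring, sin_two_mul, sin_sub, cos_sub]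
    at hYZ hA
  have hsu : 0 < sin u := sin_pos_of_pos_of_lt_pi (by linarith) (by linarith)
  have hsv : 0 < sin v := sin_pos_of_pos_of_lt_pi (by linarith) (by linarith)
  have hcu : 0 < cos u := cos_pos_of_mem_Ioo ⟨by linarith, by linarith⟩
  have hcv : 0 < cos v := cos_pos_of_mem_Ioo ⟨by linarith, by linarith⟩
  have hu1 := sin_sq_add_cos_sq u
  have hv1 := sin_sq_add_cos_sq v
  have hpos : 0 < cos v * cos u + sin v * sin u := by positivity
  rw [dist_comm Z X, hXY, hYZ, hXZ] at hp
  rw [hXY, hYZ, hXZ, tan_eq_sin_div_cos, tan_eq_sin_div_cos]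
  have hp' : p = 4 * ρ * cos u * sin v * (cos v * cos u + sin v * sin u) := by
    linear_combination hp - 2 * ρ * sin u * cos u * hv1 - 2 * ρ * sin v * cos v * hu1
  have hr' : p - 2 * ρ * (2 * sin v * cos v) =
      4 * ρ * sin u * sin v * (sin v * cos u - cos v * sin u) := by
    linear_combination hp - 2 * ρ * sin u * cos u * hv1 + 2 * ρ * sin v * cos v * hu1
  have ht' : p - 2 * ρ * (2 * sin u * cos u) =
      4 * ρ * cos u * cos v * (sin v * cos u - cos v * sin u) := by
    linear_combination hp + 2 * ρ * sin u * cos u * hv1 - 2 * ρ * sin v * cos v * hu1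
  have hs' : p - 2 * ρ * (2 * (sin v * cos u - cos v * sin u) * (cos v * cos u + sin v * sin u)) =
      4 * ρ * sin u * cos v * (cos v * cos u + sin v * sin u) := by
    linear_combination hp - 2 * ρ * sin u * cos u * hv1 - 2 * ρ * sin v * cos v * hu1
  rw [hr', ht', hs', hp', hA]
  refine ⟨?_, ?_, ?_⟩ <;> field_simp <;> ring

/-- A telescoping product of quotients of positive reals. -/
lemma prod_Ico_div_of_pos {f : ℕ → ℝ} {m k : ℕ} (hmk : m ≤ k) :
    (∀ i, m ≤ i → i ≤ k → 0 < f i) → ∏ i ∈ Finset.Ico m k, f (i + 1) / f i = f k / f m := by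
  induction k, hmk using Nat.le_induction with
  | base => exact fun hf => by simp [(hf m le_rfl le_rfl).ne']
  | succ k hmk ih =>
    intro hf
    have hm := hf m le_rfl (by lia)
    have hk := hf k hmk (by lia)
    rw [Finset.prod_Ico_succ_top hmk, ih fun i hi hik => hf i hi (by lia)]
    field_simp

/-- For the fan triangulation of a convex cyclic polygon, the product of the
areas of two of the triangles is given by
`A_h · A_k = p_h · r_h · p_k · t_k · ∏_{i=h+1}^{k-1} (p_i / s_i)`. -/
theorem cyclic_polygon_area_product_p
    (n : ℕ) (hn : 1 ≤ n)
    (Q : ℕ → EuclideanSpace ℝ (Fin 2))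
    (O : EuclideanSpace ℝ (Fin 2)) (ρ : ℝ) (θ : ℕ → ℝ)
    (hρ : 0 < ρ)
    (hθmem : ∀ i ≤ n + 1, θ i ∈ Set.Ico 0 (2 * π))
    (hθmono : StrictMonoOn θ (Set.Iic (n + 1)))
    (hQ : ∀ i ≤ n + 1,
      Q i 0 = O 0 + ρ * Real.cos (θ i) ∧ Q i 1 = O 1 + ρ * Real.sin (θ i))
    (hinj : ∀ i ≤ n + 1, ∀ j ≤ n + 1, Q i = Q j → i = j)
    (p s r t : ℕ → ℝ)
    (hp : ∀ j, 1 ≤ j → j ≤ n →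
      p j = (dist (Q 0) (Q j) + dist (Q j) (Q (j + 1)) + dist (Q (j + 1)) (Q 0)) / 2)
    (hs : ∀ j, 1 ≤ j → j ≤ n → s j = p j - dist (Q j) (Q (j + 1)))
    (hr : ∀ j, 1 ≤ j → j ≤ n → r j = p j - dist (Q 0) (Q (j + 1)))
    (ht : ∀ j, 1 ≤ j → j ≤ n → t j = p j - dist (Q 0) (Q j))
    (A : ℕ → ℝ)
    (hA : ∀ j, 1 ≤ j → j ≤ n →
      A j = (volume (convexHull ℝ
        ({Q 0, Q j, Q (j + 1)} : Set (EuclideanSpace ℝ (Fin 2))))).toReal) :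
    ∀ h k, 1 ≤ h → h < k → k ≤ n →
      A h * A k = p h * r h * p k * t k * ∏ i ∈ Finset.Icc (h + 1) (k - 1), p i / s i := by
  set τ : ℕ → ℝ := fun i => tan ((θ i - θ 0) / 4) with hτ
  have hθ0 : ∀ i, 1 ≤ i → i ≤ n + 1 → θ 0 < θ i := fun i h1 h2 =>
    hθmono (Set.mem_Iic.mpr (Nat.zero_le _)) (Set.mem_Iic.mpr h2) h1
  have hτpos : ∀ i, 1 ≤ i → i ≤ n + 1 → 0 < τ i := fun i h1 h2 => by
    have := hθ0 i h1 h2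
    have := (hθmem i h2).2
    have := (hθmem 0 (Nat.zero_le _)).1
    exact tan_pos_of_pos_of_lt_pi_div_two (by linarith) (by linarith)
  have key : ∀ j, 1 ≤ j → j ≤ n →
      p j * r j = A j * τ (j + 1) ∧ p j * t j = A j / τ j ∧ p j / s j = τ (j + 1) / τ j := by
    intro j h1 h2
    have hlt : θ j < θ (j + 1) := hθmono (Set.mem_Iic.mpr (by lia)) (Set.mem_Iic.mpr (by lia))
      (Nat.lt_succ_self j)
    have := (hθmem (j + 1) (by lia)).2
    have := (hθmem 0 (Nat.zero_le _)).1
    rw [hr j h1 h2, ht j h1 h2, hs j h1 h2]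
    exact inscribed_triangle_relations hρ (hQ 0 (Nat.zero_le _)) (hQ j (by lia))
      (hQ (j + 1) (by lia)) (hθ0 j h1 (by lia)) hlt (by linarith) (hp j h1 h2) (hA j h1 h2)
  intro h k h1 hhk hkn
  have hprod : ∏ i ∈ Finset.Icc (h + 1) (k - 1), p i / s i = τ k / τ (h + 1) := by
    rw [← prod_Ico_div_of_pos hhk fun i hi hik => hτpos i (by lia) (by lia)]
    refine Finset.prod_congr (by ext; simp; lia) fun i hi => ?_
    have := Finset.mem_Ico.mp hi
    exact (key i (by lia) (by lia)).2.2
  have hpos := hτpos (h + 1) (by lia) (by lia)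
  have hpos' := hτpos k (by lia) (by lia)
  rw [hprod, (key h h1 (by lia)).1, mul_assoc (A h * τ (h + 1)), (key k (by lia) hkn).2.1]
  field_simp
end
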